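/- arXiv:1706.04381 — 9 statements merged into one kernel-verified Lean document; each statement's English description precedes it below -/
import Mathlib

section
/- Let A be an n×n real matrix, B an n×m real matrix, X a symmetric (n+m)×(n+m) real matrix, and ρ ≥ 0. Suppose there exists a positive semidefinite n×n real matrix P such that the block matrix [[AᵀPA − ρ²P, AᵀPB], [BᵀPA, BᵀPB]] − X is negative semidefinite. Then for every pair of sequences ξ : ℕ → ℝⁿ and w : ℕ → ℝᵐ satisfying ξ_{k+1} = Aξ_k + Bw_k for all k, the storage function V(ξ) := ξᵀPξ satisfies the exponential dissipation inequality V(ξ_{k+1}) − ρ²V(ξ_k) ≤ (ξ_k; w_k)ᵀ X (ξ_k; w_k) for all k, where (ξ_k; w_k) ∈ ℝ^{n+m} denotes the stacked vector. -/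
open Matrix

/-- The bilinear form of `P` evaluated on the images of two vectors under `M` and `N`. -/
theorem dotProduct_transpose_mul_mul_mulVec {R l p q r : Type*} [CommSemiring R]
    [Fintype l] [Fintype p] [Fintype q] [Fintype r]
    (M : Matrix p l R) (P : Matrix p q R) (N : Matrix q r R) (a : l → R) (b : r → R) :
    a ⬝ᵥ (Mᵀ * P * N) *ᵥ b = (M *ᵥ a) ⬝ᵥ P *ᵥ (N *ᵥ b) := by
  rw [← mulVec_mulVec, ← mulVec_mulVec, dotProduct_mulVec, vecMul_transpose]

/-- Discrete-time dissipation inequality via an LMI (Theorem 1). -/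
theorem discrete_dissipation_inequality {n m : ℕ}
    (A : Matrix (Fin n) (Fin n) ℝ) (B : Matrix (Fin n) (Fin m) ℝ)
    (X : Matrix (Fin n ⊕ Fin m) (Fin n ⊕ Fin m) ℝ) (hX : X.IsSymm)
    (ρ : ℝ) (hρ : 0 ≤ ρ)
    (P : Matrix (Fin n) (Fin n) ℝ)
    (hPsd : ∀ v : Fin n → ℝ, 0 ≤ v ⬝ᵥ P.mulVec v)
    (hLMI : ∀ v : Fin n ⊕ Fin m → ℝ,
      v ⬝ᵥ ((Matrix.fromBlocks (Aᵀ * P * A - ρ ^ 2 • P) (Aᵀ * P * B)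
        (Bᵀ * P * A) (Bᵀ * P * B) - X).mulVec v) ≤ 0)
    (ξ : ℕ → Fin n → ℝ) (w : ℕ → Fin m → ℝ)
    (hdyn : ∀ k, ξ (k + 1) = A.mulVec (ξ k) + B.mulVec (w k)) :
    ∀ k, (ξ (k + 1)) ⬝ᵥ P.mulVec (ξ (k + 1)) - ρ ^ 2 * ((ξ k) ⬝ᵥ P.mulVec (ξ k)) ≤
      (Sum.elim (ξ k) (w k)) ⬝ᵥ X.mulVec (Sum.elim (ξ k) (w k)) := by
  intro k
  have h := hLMI (Sum.elim (ξ k) (w k))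
  rw [sub_mulVec, dotProduct_sub, fromBlocks_mulVec, sumElim_dotProduct_sumElim] at h
  simp only [Sum.elim_comp_inl, Sum.elim_comp_inr, sub_mulVec, smul_mulVec, dotProduct_add,
    dotProduct_sub, dotProduct_smul, smul_eq_mul, dotProduct_transpose_mul_mul_mulVec] at h
  rw [hdyn k]
  simp only [mulVec_add, dotProduct_add, add_dotProduct]
  linarith
end

section
/- Let f : ℝ^p → ℝ be differentiable, L-smooth and m-strongly convex with 0 < m ≤ L, and let x⋆ be the unique point with ∇f(x⋆) = 0. Consider gradient descent x_{k+1} = x_k − α∇f(x_k) with step size α = 1/L. Then for all k, ‖x_{k+1} − x⋆‖ ≤ (1 − m/L)‖x_k − x⋆‖. -/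
open RealInnerProductSpace

/-- The descent lemma: a function with `L`-Lipschitz gradient is bounded above by its
quadratic Taylor model with curvature `L`. -/
theorem le_add_inner_add_of_gradient_lipschitz {E : Type*} [NormedAddCommGroup E]
    [InnerProductSpace ℝ E] [CompleteSpace E] {f : E → ℝ} {L : ℝ} (hf : Differentiable ℝ f)
    (hsmooth : ∀ x y, ‖gradient f x - gradient f y‖ ≤ L * ‖x - y‖) (b v : E) :
    f (b + v) ≤ f b + ⟪gradient f b, v⟫ + L / 2 * ‖v‖ ^ 2 := by
  have hderiv (t : ℝ) : HasDerivAt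
      (fun t : ℝ => f (b + t • v) - t * ⟪gradient f b, v⟫ - L / 2 * ‖v‖ ^ 2 * t ^ 2)
      (⟪gradient f (b + t • v), v⟫ - ⟪gradient f b, v⟫ - L * ‖v‖ ^ 2 * t) t := by
    have hline : HasDerivAt (fun t : ℝ => b + t • v) v t := by
      simpa using ((hasDerivAt_id t).smul_const v).const_add b
    have hcomp := (hf (b + t • v)).hasGradientAt.hasFDerivAt.comp_hasDerivAt t hline
    have hlin := (hasDerivAt_id t).mul_const ⟪gradient f b, v⟫
    have hquad := ((hasDerivAt_id t).pow 2).const_mul (L / 2 * ‖v‖ ^ 2)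
    refine ((hcomp.sub hlin).sub hquad).congr_deriv ?_
    simp
    ring
  have hanti := antitoneOn_of_deriv_nonpos (convex_Icc (0 : ℝ) 1)
    (fun t _ => (hderiv t).continuousAt.continuousWithinAt)
    (fun t _ => (hderiv t).differentiableAt.differentiableWithinAt) (fun t ht => by
      rw [interior_Icc] at ht
      rw [(hderiv t).deriv, ← inner_sub_left]
      have hlip := hsmooth (b + t • v) b
      rw [add_sub_cancel_left, norm_smul, Real.norm_of_nonneg ht.1.le] at hlip
      have hcs := real_inner_le_norm (gradient f (b + t • v) - gradient f b) v
      have hmul := mul_le_mul_of_nonneg_right hlip (norm_nonneg v)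
      linarith)
  have h01 := hanti (Set.left_mem_Icc.2 zero_le_one) (Set.right_mem_Icc.2 zero_le_one)
    zero_le_one
  simp only [one_smul, zero_smul, add_zero] at h01
  linarith

/-- If `f` is `m`-strongly convex with `L`-Lipschitz gradient, then the gradient of
`f - m / 2 * ‖·‖ ^ 2` is cocoercive with constant `1 / (L - m)`. -/
theorem norm_sq_le_mul_inner_of_gradient_lipschitz {E : Type*} [NormedAddCommGroup E]
    [InnerProductSpace ℝ E] [CompleteSpace E] {f : E → ℝ} {L m : ℝ} (hmL : m ≤ L)
    (hf : Differentiable ℝ f)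
    (hsmooth : ∀ x y, ‖gradient f x - gradient f y‖ ≤ L * ‖x - y‖)
    (hsc : ∀ x y, f x ≥ f y + ⟪gradient f y, x - y⟫ + m / 2 * ‖x - y‖ ^ 2) (x y : E) :
    ‖gradient f x - gradient f y - m • (x - y)‖ ^ 2 ≤
      (L - m) * ⟪gradient f x - gradient f y - m • (x - y), x - y⟫ := by
  obtain ⟨u, hu⟩ : ∃ u, u = gradient f x - gradient f y - m • (x - y) := ⟨_, rfl⟩
  rw [← hu]
  have hgx : gradient f x = u + gradient f y + m • (x - y) := by rw [hu]; abel
  have key (t : ℝ) : 2 * t * ‖u‖ ^ 2 - t ^ 2 * (L - m) * ‖u‖ ^ 2 ≤ ⟪u, x - y⟫ := by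
    have h₁ := le_add_inner_add_of_gradient_lipschitz hf hsmooth x (-(t • u))
    have h₂ := le_add_inner_add_of_gradient_lipschitz hf hsmooth y (t • u)
    have h₃ := hsc (x + -(t • u)) y
    have h₄ := hsc (y + t • u) x
    rw [show x + -(t • u) - y = (x - y) - t • u by abel] at h₃
    rw [show y + t • u - x = -((x - y) - t • u) by abel] at h₄
    rw [hgx] at h₁ h₄
    generalize x - y = d at *
    simp only [norm_neg, norm_sub_sq_real, norm_smul, mul_pow, Real.norm_eq_abs, sq_abs,
      inner_neg_right, inner_sub_right, inner_add_left, inner_smul_left, inner_smul_right,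
      real_inner_self_eq_norm_sq, RCLike.conj_to_real] at h₁ h₂ h₃ h₄ ⊢
    rw [real_inner_comm u d] at *
    linarith
  rcases hmL.eq_or_lt with rfl | hlt
  · by_contra! hpos
    simp only [sub_self, zero_mul, mul_zero, sub_zero] at hpos key
    have h := key ((⟪u, x - y⟫ + 1) / (2 * ‖u‖ ^ 2))
    rw [mul_right_comm, mul_div_cancel₀ _ (by positivity)] at h
    linarith
  · have hM : 0 < L - m := sub_pos.2 hlt
    have h := mul_le_mul_of_nonneg_left (key (1 / (L - m))) hM.le
    field_simp at h
    linarith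

/-- Linear convergence of gradient descent with step size `α = 1/L`:
`‖x_{k+1} − x⋆‖ ≤ (1 − m/L)‖x_k − x⋆‖`. -/
theorem gradient_descent_rate_one_over_L {p : ℕ} (f : EuclideanSpace ℝ (Fin p) → ℝ)
    (L m : ℝ) (hm : 0 < m) (hmL : m ≤ L)
    (hf : Differentiable ℝ f)
    (hsmooth : ∀ x y, ‖gradient f x - gradient f y‖ ≤ L * ‖x - y‖)
    (hsc : ∀ x y, f x ≥ f y + ⟪gradient f y, x - y⟫ + m / 2 * ‖x - y‖ ^ 2)
    (xs : EuclideanSpace ℝ (Fin p)) (hxs : gradient f xs = 0)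
    (x : ℕ → EuclideanSpace ℝ (Fin p))
    (hiter : ∀ k, x (k + 1) = x k - (1 / L) • gradient f (x k)) :
    ∀ k, ‖x (k + 1) - xs‖ ≤ (1 - m / L) * ‖x k - xs‖ := by
  intro k
  have hL : 0 < L := hm.trans_le hmL
  have hM : 0 ≤ L - m := sub_nonneg.2 hmL
  have hco := norm_sq_le_mul_inner_of_gradient_lipschitz hmL hf hsmooth hsc (x k) xs
  rw [hxs, sub_zero] at hco
  have hrate : 1 - m / L = (L - m) / L := by field_simp
  obtain ⟨u, hu⟩ : ∃ u, u = gradient f (x k) - m • (x k - xs) := ⟨_, rfl⟩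
  rw [← hu] at hco
  have hstep : x (k + 1) - xs = (1 / L) • ((L - m) • (x k - xs) - u) := by
    have hLL : (1 / L) • (L • (x k - xs)) = x k - xs := by
      rw [smul_smul, one_div_mul_cancel hL.ne', one_smul]
    rw [hiter, hu, sub_smul, sub_sub_sub_cancel_right, smul_sub, hLL]
    abel
  have hnorm : ‖(L - m) • (x k - xs) - u‖ ≤ (L - m) * ‖x k - xs‖ := by
    refine abs_le_of_sq_le_sq' ?_ (by positivity) |>.2
    rw [norm_sub_sq_real, norm_smul, inner_smul_left, real_inner_comm, mul_pow,
      Real.norm_eq_abs, sq_abs, RCLike.conj_to_real, mul_pow]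
    nlinarith [sq_nonneg ‖u‖]
  rw [hstep, norm_smul, Real.norm_of_nonneg (by positivity), hrate]
  calc 1 / L * ‖(L - m) • (x k - xs) - u‖ ≤ 1 / L * ((L - m) * ‖x k - xs‖) := by gcongr
    _ = (L - m) / L * ‖x k - xs‖ := by ring
end

section
/- Let f : ℝ^p → ℝ be differentiable, L-smooth and m-strongly convex with 0 < m ≤ L, and let x⋆ be the unique point with ∇f(x⋆) = 0. Consider gradient descent x_{k+1} = x_k − α∇f(x_k) with step size α = 2/(L+m). Then for all k, ‖x_{k+1} − x⋆‖ ≤ ((L−m)/(L+m))‖x_k − x⋆‖. -/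
open RealInnerProductSpace

section GradientInequalities

variable {E : Type*} [NormedAddCommGroup E] [InnerProductSpace ℝ E] [CompleteSpace E]

/-- Descent lemma: a function with `L`-Lipschitz gradient lies below its quadratic upper model. -/
lemma Differentiable.le_add_inner_gradient_add_sq {f : E → ℝ} {L : ℝ} (hf : Differentiable ℝ f)
    (hL : ∀ x y, ‖gradient f x - gradient f y‖ ≤ L * ‖x - y‖) (x u : E) :
    f (x + u) ≤ f x + ⟪gradient f x, u⟫ + L / 2 * ‖u‖ ^ 2 := by
  let φ : ℝ → ℝ := fun t => f (x + t • u) - (t * ⟪gradient f x, u⟫ + L / 2 * ‖u‖ ^ 2 * t ^ 2)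
  have hφ (t : ℝ) : HasDerivAt φ
      (⟪gradient f (x + t • u), u⟫ - (⟪gradient f x, u⟫ + L * ‖u‖ ^ 2 * t)) t := by
    have hline : HasDerivAt (fun s : ℝ => x + s • u) u t := by
      simpa using ((hasDerivAt_id t).smul_const u).const_add x
    have hcomp := (hf (x + t • u)).hasGradientAt.hasFDerivAt.comp_hasDerivAt t hline
    have hquad := ((hasDerivAt_id t).mul_const ⟪gradient f x, u⟫).add
      ((hasDerivAt_pow 2 t).const_mul (L / 2 * ‖u‖ ^ 2))
    refine (hcomp.sub hquad).congr_deriv ?_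
    simp only [InnerProductSpace.toDual_apply_apply, Nat.cast_ofNat, Nat.add_one_sub_one, pow_one]
    ring
  have hanti : AntitoneOn φ (Set.Icc 0 1) := by
    refine antitoneOn_of_deriv_nonpos (convex_Icc 0 1)
      (fun t _ => (hφ t).continuousAt.continuousWithinAt)
      (fun t _ => (hφ t).differentiableAt.differentiableWithinAt) fun t ht => ?_
    rw [interior_Icc] at ht
    rw [(hφ t).deriv]
    have hgrad := hL (x + t • u) x
    rw [add_sub_cancel_left, norm_smul, Real.norm_of_nonneg ht.1.le] at hgrad
    have hinner := real_inner_le_norm (gradient f (x + t • u) - gradient f x) u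
    rw [inner_sub_left] at hinner
    nlinarith [mul_le_mul_of_nonneg_right hgrad (norm_nonneg u)]
  have h := hanti (Set.left_mem_Icc.2 zero_le_one) (Set.right_mem_Icc.2 zero_le_one) zero_le_one
  simp only [φ, one_smul, zero_smul, add_zero] at h
  linarith

/-- Interpolation inequality for smooth strongly convex functions. -/
lemma Differentiable.interpolation_of_strongConvex {f : E → ℝ} {L m : ℝ} (hmL : m < L)
    (hf : Differentiable ℝ f)
    (hL : ∀ x y, ‖gradient f x - gradient f y‖ ≤ L * ‖x - y‖)
    (hsc : ∀ x y, f x ≥ f y + ⟪gradient f y, x - y⟫ + m / 2 * ‖x - y‖ ^ 2) (x y : E) :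
    f y + ⟪gradient f y, x - y⟫ + m / 2 * ‖x - y‖ ^ 2
      + ‖m • (x - y) - (gradient f x - gradient f y)‖ ^ 2 / (2 * (L - m)) ≤ f x := by
  have hpos : 0 < L - m := sub_pos.2 hmL
  obtain ⟨s, hs⟩ : ∃ s, s * (L - m) = 1 := ⟨(L - m)⁻¹, inv_mul_cancel₀ hpos.ne'⟩
  set w := m • (x - y) - (gradient f x - gradient f y) with hw
  have hup := hf.le_add_inner_gradient_add_sq hL x (s • w)
  have hlow := hsc (x + s • w) y
  rw [show x + s • w - y = (x - y) + s • w by abel, norm_add_sq_real, inner_add_right] at hlow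
  have hww : m * ⟪x - y, w⟫ - (⟪gradient f x, w⟫ - ⟪gradient f y, w⟫) = ‖w‖ ^ 2 := by
    rw [← real_inner_self_eq_norm_sq w]
    conv_rhs => rw [hw, inner_sub_left, inner_sub_left, real_inner_smul_left, ← hw]
  simp only [norm_smul, real_inner_smul_right, mul_pow, Real.norm_eq_abs, sq_abs] at hup hlow
  have hdiv : ‖w‖ ^ 2 / (2 * (L - m)) = s / 2 * ‖w‖ ^ 2 := by
    rw [div_eq_iff (by positivity)]
    linear_combination (-‖w‖ ^ 2) * hs
  rw [hdiv]
  have hsq : s ^ 2 * (L - m) * ‖w‖ ^ 2 = s * ‖w‖ ^ 2 := by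
    linear_combination s * ‖w‖ ^ 2 * hs
  linear_combination hup + hlow - s * hww + hsq / 2

/-- Strengthened co-coercivity of the gradient of a smooth strongly convex function. -/
lemma Differentiable.inner_gradient_sub_ge_of_strongConvex {f : E → ℝ} {L m : ℝ} (hm : 0 ≤ m)
    (hmL : m ≤ L) (hf : Differentiable ℝ f)
    (hL : ∀ x y, ‖gradient f x - gradient f y‖ ≤ L * ‖x - y‖)
    (hsc : ∀ x y, f x ≥ f y + ⟪gradient f y, x - y⟫ + m / 2 * ‖x - y‖ ^ 2) (x y : E) :
    ‖gradient f x - gradient f y‖ ^ 2 + L * m * ‖x - y‖ ^ 2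
      ≤ (L + m) * ⟪gradient f x - gradient f y, x - y⟫ := by
  rcases hmL.eq_or_lt with rfl | hlt
  · have hxy := hsc x y
    have hyx := hsc y x
    rw [← neg_sub x y, inner_neg_right, norm_neg] at hyx
    have hsq := pow_le_pow_left₀ (norm_nonneg _) (hL x y) 2
    rw [inner_sub_left]
    nlinarith
  · have hxy := hf.interpolation_of_strongConvex hlt hL hsc x y
    have hyx := hf.interpolation_of_strongConvex hlt hL hsc y x
    rw [← neg_sub x y, ← neg_sub (gradient f x) (gradient f y), smul_neg, ← neg_sub',
      inner_neg_right, norm_neg, norm_neg] at hyx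
    have hpos : 0 < L - m := sub_pos.2 hlt
    have hsum : ‖m • (x - y) - (gradient f x - gradient f y)‖ ^ 2 / (L - m)
        ≤ ⟪gradient f x - gradient f y, x - y⟫ - m * ‖x - y‖ ^ 2 := by
      rw [inner_sub_left]
      rw [mul_comm 2, ← div_div] at hxy hyx
      linarith
    rw [div_le_iff₀ hpos, norm_sub_sq_real, real_inner_smul_left, norm_smul, mul_pow,
      Real.norm_eq_abs, sq_abs, real_inner_comm] at hsum
    linarith

end GradientInequalities

/-- Linear convergence of gradient descent with step size `α = 2/(L+m)`:
`‖x_{k+1} − x⋆‖ ≤ ((L−m)/(L+m))‖x_k − x⋆‖`. -/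
theorem gradient_descent_rate_two_over_LplusM {p : ℕ} (f : EuclideanSpace ℝ (Fin p) → ℝ)
    (L m : ℝ) (hm : 0 < m) (hmL : m ≤ L)
    (hf : Differentiable ℝ f)
    (hsmooth : ∀ x y, ‖gradient f x - gradient f y‖ ≤ L * ‖x - y‖)
    (hsc : ∀ x y, f x ≥ f y + ⟪gradient f y, x - y⟫ + m / 2 * ‖x - y‖ ^ 2)
    (xs : EuclideanSpace ℝ (Fin p)) (hxs : gradient f xs = 0)
    (x : ℕ → EuclideanSpace ℝ (Fin p))
    (hiter : ∀ k, x (k + 1) = x k - (2 / (L + m)) • gradient f (x k)) :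
    ∀ k, ‖x (k + 1) - xs‖ ≤ ((L - m) / (L + m)) * ‖x k - xs‖ := by
  intro k
  have hpos : 0 < L + m := by linarith
  have hco := hf.inner_gradient_sub_ge_of_strongConvex hm.le hmL hsmooth hsc (x k) xs
  rw [hxs, sub_zero] at hco
  have hrate : 0 ≤ (L - m) / (L + m) := div_nonneg (sub_nonneg.2 hmL) hpos.le
  refine abs_le_of_sq_le_sq' ?_ (mul_nonneg hrate (norm_nonneg _)) |>.2
  rw [hiter k, sub_right_comm, norm_sub_sq_real, real_inner_smul_right, norm_smul, mul_pow,
    Real.norm_eq_abs, sq_abs, real_inner_comm, mul_pow, ← sub_nonneg]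
  have hgap : ((L - m) / (L + m)) ^ 2 * ‖x k - xs‖ ^ 2
      - (‖x k - xs‖ ^ 2 - 2 * (2 / (L + m) * ⟪gradient f (x k), x k - xs⟫)
        + (2 / (L + m)) ^ 2 * ‖gradient f (x k)‖ ^ 2)
      = 4 / (L + m) ^ 2 * ((L + m) * ⟪gradient f (x k), x k - xs⟫
        - (‖gradient f (x k)‖ ^ 2 + L * m * ‖x k - xs‖ ^ 2)) := by
    field_simp
    ring
  rw [hgap]
  exact mul_nonneg (by positivity) (sub_nonneg.2 hco)
end

section
/- Let f : ℝ^p → ℝ be differentiable, L-smooth and m-strongly convex with 0 < m ≤ L, let x⋆ be the unique point with ∇f(x⋆) = 0, and let α, β ∈ ℝ. Given x_k, x_{k−1} ∈ ℝ^p, set y_k = (1+β)x_k − βx_{k−1} and x_{k+1} = y_k − α∇f(y_k). Then (1/2)·( m‖y_k − x⋆‖² − 2⟨∇f(y_k), y_k − x⋆⟩ + α(2 − Lα)‖∇f(y_k)‖² ) ≤ f(x⋆) − f(x_{k+1}). -/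
open RealInnerProductSpace

/-- The descent lemma: a differentiable function with `L`-Lipschitz gradient is bounded above by
its quadratic model. -/
theorem le_quadratic_of_gradient_lipschitz {E : Type*} [NormedAddCommGroup E]
    [InnerProductSpace ℝ E] [CompleteSpace E] {f : E → ℝ} {L : ℝ} (hf : Differentiable ℝ f)
    (hsmooth : ∀ x y, ‖gradient f x - gradient f y‖ ≤ L * ‖x - y‖) (y v : E) :
    f (y + v) ≤ f y + ⟪gradient f y, v⟫ + L / 2 * ‖v‖ ^ 2 := by
  let φ : ℝ → ℝ := fun t => f (y + t • v) - t * ⟪gradient f y, v⟫ - L / 2 * ‖v‖ ^ 2 * t ^ 2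
  have hφ : ∀ t, HasDerivAt φ
      (⟪gradient f (y + t • v) - gradient f y, v⟫ - L * ‖v‖ ^ 2 * t) t := by
    intro t
    have hline : HasDerivAt (fun t : ℝ => y + t • v) v t := by
      simpa using ((hasDerivAt_id t).smul_const v).const_add y
    have hcomp : HasDerivAt (fun t : ℝ => f (y + t • v)) ⟪gradient f (y + t • v), v⟫ t := by
      simpa [Function.comp_def] using
        (hf (y + t • v)).hasGradientAt.hasFDerivAt.comp_hasDerivAt t hline
    refine ((hcomp.sub ((hasDerivAt_id t).mul_const ⟪gradient f y, v⟫)).sub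
      ((hasDerivAt_pow 2 t).const_mul (L / 2 * ‖v‖ ^ 2))).congr_deriv ?_
    rw [inner_sub_left]
    push_cast
    ring
  have hanti : AntitoneOn φ (Set.Icc 0 1) := by
    refine antitoneOn_of_deriv_nonpos (convex_Icc 0 1)
      (fun t _ => (hφ t).continuousAt.continuousWithinAt)
      (fun t _ => (hφ t).differentiableAt.differentiableWithinAt) fun t ht => ?_
    rw [interior_Icc] at ht
    rw [(hφ t).deriv, sub_nonpos]
    calc ⟪gradient f (y + t • v) - gradient f y, v⟫
        ≤ ‖gradient f (y + t • v) - gradient f y‖ * ‖v‖ := real_inner_le_norm _ _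
      _ ≤ L * ‖(y + t • v) - y‖ * ‖v‖ := by gcongr; exact hsmooth _ _
      _ = L * ‖v‖ ^ 2 * t := by
        rw [add_sub_cancel_left, norm_smul, Real.norm_of_nonneg ht.1.le]
        ring
  have h := hanti (Set.left_mem_Icc.2 zero_le_one) (Set.right_mem_Icc.2 zero_le_one) zero_le_one
  simp only [φ, one_smul, zero_smul, add_zero] at h
  linarith

/-- Second quadratic-form inequality (weight matrix `X₂`) of Lemma 3 for Nesterov's
accelerated method. -/
theorem nesterov_supply_rate_X2 {p : ℕ} (f : EuclideanSpace ℝ (Fin p) → ℝ)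
    (L m : ℝ) (hm : 0 < m) (hmL : m ≤ L)
    (hf : Differentiable ℝ f)
    (hsmooth : ∀ x y, ‖gradient f x - gradient f y‖ ≤ L * ‖x - y‖)
    (hsc : ∀ x y, f x ≥ f y + ⟪gradient f y, x - y⟫ + m / 2 * ‖x - y‖ ^ 2)
    (xs : EuclideanSpace ℝ (Fin p)) (hxs : gradient f xs = 0)
    (α β : ℝ) (xk xkm1 yk xkp1 : EuclideanSpace ℝ (Fin p))
    (hy : yk = (1 + β) • xk - β • xkm1)
    (hx : xkp1 = yk - α • gradient f yk) :
    1 / 2 * (m * ‖yk - xs‖ ^ 2 - 2 * ⟪gradient f yk, yk - xs⟫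
        + α * (2 - L * α) * ‖gradient f yk‖ ^ 2) ≤ f xs - f xkp1 := by
  have hdesc := le_quadratic_of_gradient_lipschitz hf hsmooth yk (-(α • gradient f yk))
  rw [← sub_eq_add_neg, ← hx, inner_neg_right, inner_smul_right, real_inner_self_eq_norm_sq,
    norm_neg, norm_smul, mul_pow, Real.norm_eq_abs, sq_abs] at hdesc
  have hlow := hsc xs yk
  rw [← neg_sub yk xs, inner_neg_right, norm_neg] at hlow
  linarith
end

section
/- Let f : ℝ^p → ℝ be differentiable, L-smooth and m-strongly convex with 0 < m ≤ L, and let x⋆ be the unique point with ∇f(x⋆) = 0. Set κ = L/m, α = 1/L and β = (√κ − 1)/(√κ + 1), and consider Nesterov's accelerated method x_{k+1} = y_k − α∇f(y_k), y_k = (1+β)x_k − βx_{k−1}. Define 𝒱_k := ‖√(L/2)·(x_k − x⋆) + (√(m/2) − √(L/2))·(x_{k−1} − x⋆)‖² + f(x_k) − f(x⋆). Then 𝒱_{k+1} ≤ (1 − √(m/L))·𝒱_k for all k, and hence f(x_k) − f(x⋆) ≤ (1 − √(m/L))^k · 𝒱₀ for all k. -/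
open RealInnerProductSpace

/-- The descent lemma for functions with Lipschitz gradient. -/
theorem le_add_inner_add_norm_sq_of_lipschitz_gradient {E : Type*} [NormedAddCommGroup E]
    [InnerProductSpace ℝ E] [CompleteSpace E] {f : E → ℝ} {L : ℝ} (hf : Differentiable ℝ f)
    (hsmooth : ∀ x y, ‖gradient f x - gradient f y‖ ≤ L * ‖x - y‖) (y d : E) :
    f (y + d) ≤ f y + ⟪gradient f y, d⟫ + L / 2 * ‖d‖ ^ 2 := by
  let φ : ℝ → ℝ := fun t => f (y + t • d) - t * ⟪gradient f y, d⟫ - L / 2 * ‖d‖ ^ 2 * t ^ 2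
  have hφ (t : ℝ) : HasDerivAt φ
      (⟪gradient f (y + t • d), d⟫ - ⟪gradient f y, d⟫ - L / 2 * ‖d‖ ^ 2 * (2 * t)) t := by
    have hline : HasDerivAt (fun s : ℝ => y + s • d) d t := by
      simpa using ((hasDerivAt_id t).smul_const d).const_add y
    have hcomp := (hf (y + t • d)).hasGradientAt.hasFDerivAt.comp_hasDerivAt t hline
    rw [InnerProductSpace.toDual_apply_apply] at hcomp
    have hlin := (hasDerivAt_id t).mul_const ⟪gradient f y, d⟫
    have hsq := ((hasDerivAt_id t).pow 2).const_mul (L / 2 * ‖d‖ ^ 2)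
    exact ((hcomp.sub hlin).sub hsq).congr_deriv (by simp)
  have hanti : AntitoneOn φ (Set.Icc 0 1) := by
    refine antitoneOn_of_deriv_nonpos (convex_Icc 0 1)
      (fun t _ => (hφ t).continuousAt.continuousWithinAt)
      (fun t _ => (hφ t).differentiableAt.differentiableWithinAt) fun t ht => ?_
    rw [interior_Icc] at ht
    rw [(hφ t).deriv, ← inner_sub_left]
    have hgrad : ‖gradient f (y + t • d) - gradient f y‖ ≤ L * (t * ‖d‖) := by
      simpa [norm_smul, abs_of_pos ht.1] using hsmooth (y + t • d) y
    have hcs := real_inner_le_norm (gradient f (y + t • d) - gradient f y) d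
    have hmul := mul_le_mul_of_nonneg_right hgrad (norm_nonneg d)
    linarith
  have h := hanti (Set.left_mem_Icc.2 zero_le_one) (Set.right_mem_Icc.2 zero_le_one) zero_le_one
  simp only [φ, one_smul, zero_smul, add_zero] at h
  linarith

/-- A gradient step of length `1 / L` decreases `f` by at least `‖∇f‖² / (2L)`. -/
theorem gradient_step_le_of_lipschitz_gradient {E : Type*} [NormedAddCommGroup E]
    [InnerProductSpace ℝ E] [CompleteSpace E] {f : E → ℝ} {L : ℝ} (hL : 0 < L)
    (hf : Differentiable ℝ f)
    (hsmooth : ∀ x y, ‖gradient f x - gradient f y‖ ≤ L * ‖x - y‖) (y : E) :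
    f (y - (1 / L) • gradient f y) ≤ f y - ‖gradient f y‖ ^ 2 / (2 * L) := by
  have h := le_add_inner_add_norm_sq_of_lipschitz_gradient hf hsmooth y
    (-((1 / L) • gradient f y))
  rw [← sub_eq_add_neg, inner_neg_right, real_inner_smul_right, real_inner_self_eq_norm_sq,
    norm_neg, norm_smul, Real.norm_eq_abs, abs_of_pos (one_div_pos.2 hL)] at h
  refine h.trans_eq ?_
  field_simp
  ring

/-- The quadratic part of the Lyapunov decrease, in the coordinates `w = y - x⋆`, `d = y - x`. -/
theorem nesterov_quadratic_decrease {E : Type*} [NormedAddCommGroup E] [InnerProductSpace ℝ E]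
    {A B : ℝ} (hB : 0 < B) (hBA : B ≤ A) (w d g : E) :
    ‖B • w + (A - B) • d - (1 / (2 * A)) • g‖ ^ 2 ≤
      (1 - B / A) * ‖B • w + A • d‖ ^ 2 + ‖g‖ ^ 2 / (4 * A ^ 2)
        - (1 - B / A) * (⟪g, d⟫ - B ^ 2 * ‖d‖ ^ 2) - B / A * (⟪g, w⟫ - B ^ 2 * ‖w‖ ^ 2) := by
  have hA : 0 < A := hB.trans_le hBA
  have hnonneg : 0 ≤ B * (A - B) * (A + B) / A * ‖d‖ ^ 2 := by
    have := sub_nonneg.2 hBA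
    positivity
  rw [← sub_nonneg]
  refine hnonneg.trans_eq ?_
  simp only [← real_inner_self_eq_norm_sq, inner_add_left, inner_add_right, inner_sub_left,
    inner_sub_right, real_inner_smul_left, real_inner_smul_right]
  rw [real_inner_comm w d, real_inner_comm g d, real_inner_comm g w]
  field_simp
  ring

/-- One step of Nesterov's method decreases the Lyapunov function, where `L = 2A²`, `m = 2B²`. -/
theorem nesterov_lyapunov_step {E : Type*} [NormedAddCommGroup E] [InnerProductSpace ℝ E]
    [CompleteSpace E] {f : E → ℝ} {A B : ℝ} (hB : 0 < B) (hBA : B ≤ A)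
    (hf : Differentiable ℝ f)
    (hsmooth : ∀ x y, ‖gradient f x - gradient f y‖ ≤ 2 * A ^ 2 * ‖x - y‖)
    (hsc : ∀ x y, f x ≥ f y + ⟪gradient f y, x - y⟫ + B ^ 2 * ‖x - y‖ ^ 2)
    {xs x xm y x' : E} (hy : y = (1 + (A - B) / (A + B)) • x - ((A - B) / (A + B)) • xm)
    (hx' : x' = y - (1 / (2 * A ^ 2)) • gradient f y) :
    ‖A • (x' - xs) + (B - A) • (x - xs)‖ ^ 2 + (f x' - f xs) ≤
      (1 - B / A) * (‖A • (x - xs) + (B - A) • (xm - xs)‖ ^ 2 + (f x - f xs)) := by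
  have hA : 0 < A := hB.trans_le hBA
  have hAB : A + B ≠ 0 := by positivity
  have hnext : A • (x' - xs) + (B - A) • (x - xs) =
      B • (y - xs) + (A - B) • (y - x) - (1 / (2 * A)) • gradient f y := by
    rw [hx']
    match_scalars <;> field_simp <;> ring
  have hcur : A • (x - xs) + (B - A) • (xm - xs) = B • (y - xs) + A • (y - x) := by
    rw [hy]
    match_scalars <;> field_simp <;> ring
  have hquad := nesterov_quadratic_decrease hB hBA (y - xs) (y - x) (gradient f y)
  have hdesc := gradient_step_le_of_lipschitz_gradient (by positivity) hf hsmooth y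
  rw [← hx', show 2 * (2 * A ^ 2) = 4 * A ^ 2 by ring] at hdesc
  have hscx := hsc x y
  have hscs := hsc xs y
  rw [← neg_sub y x, inner_neg_right, norm_neg] at hscx
  rw [← neg_sub y xs, inner_neg_right, norm_neg] at hscs
  have hr : 0 ≤ 1 - B / A := sub_nonneg.2 ((div_le_one hA).2 hBA)
  have hr' : 0 ≤ B / A := by positivity
  rw [hnext, hcur]
  linarith [mul_le_mul_of_nonneg_left hscx hr, mul_le_mul_of_nonneg_left hscs hr']

/-- Recovery of the accelerated linear rate `ρ² = 1 − √(m/L)` for Nesterov's method via the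
explicit Lyapunov certificate `P̃ = vvᵀ` with `v = (√(L/2), √(m/2) − √(L/2))`. -/
theorem nesterov_accelerated_rate {p : ℕ} (f : EuclideanSpace ℝ (Fin p) → ℝ)
    (L m : ℝ) (hm : 0 < m) (hmL : m ≤ L)
    (hf : Differentiable ℝ f)
    (hsmooth : ∀ x y, ‖gradient f x - gradient f y‖ ≤ L * ‖x - y‖)
    (hsc : ∀ x y, f x ≥ f y + ⟪gradient f y, x - y⟫ + m / 2 * ‖x - y‖ ^ 2)
    (xs : EuclideanSpace ℝ (Fin p)) (hxs : gradient f xs = 0)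
    (κ α β : ℝ) (hκ : κ = L / m) (hα : α = 1 / L)
    (hβ : β = (Real.sqrt κ - 1) / (Real.sqrt κ + 1))
    (x xm : ℕ → EuclideanSpace ℝ (Fin p))
    (hxm : ∀ k, xm (k + 1) = x k)
    (hiter : ∀ k, x (k + 1) = ((1 + β) • x k - β • xm k)
        - α • gradient f ((1 + β) • x k - β • xm k))
    (V : ℕ → ℝ)
    (hV : ∀ k, V k = ‖Real.sqrt (L / 2) • (x k - xs)
        + (Real.sqrt (m / 2) - Real.sqrt (L / 2)) • (xm k - xs)‖ ^ 2 + (f (x k) - f xs)) :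
    (∀ k, V (k + 1) ≤ (1 - Real.sqrt (m / L)) * V k) ∧
      ∀ k, f (x k) - f xs ≤ (1 - Real.sqrt (m / L)) ^ k * V 0 := by
  have hL : 0 < L := hm.trans_le hmL
  set A := √(L / 2) with hAdef
  set B := √(m / 2) with hBdef
  have hB : 0 < B := Real.sqrt_pos.2 (by positivity)
  have hBA : B ≤ A := Real.sqrt_le_sqrt (by linarith)
  have hA : 0 < A := hB.trans_le hBA
  have hLA : L = 2 * A ^ 2 := by
    rw [hAdef, Real.sq_sqrt (by positivity)]
    ring
  have hmB : m = 2 * B ^ 2 := by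
    rw [hBdef, Real.sq_sqrt (by positivity)]
    ring
  clear_value A B
  have hrate : √(m / L) = B / A := by
    rw [hLA, hmB, mul_div_mul_left _ _ two_ne_zero, ← div_pow, Real.sqrt_sq (by positivity)]
  have hcond : √κ = A / B := by
    rw [hκ, hLA, hmB, mul_div_mul_left _ _ two_ne_zero, ← div_pow, Real.sqrt_sq (by positivity)]
  have hβ' : β = (A - B) / (A + B) := by
    rw [hβ, hcond]
    field_simp
  have hr : 0 ≤ 1 - B / A := sub_nonneg.2 ((div_le_one hA).2 hBA)
  have hstep (k : ℕ) : V (k + 1) ≤ (1 - √(m / L)) * V k := by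
    rw [hV, hV, hxm, hrate]
    refine nesterov_lyapunov_step hB hBA hf (fun x y => hLA ▸ hsmooth x y) (fun x y => ?_)
      (congrArg (fun b : ℝ => (1 + b) • x k - b • xm k) hβ') ?_
    · have h := hsc x y
      rwa [hmB, mul_div_cancel_left₀ _ two_ne_zero] at h
    · rw [← hLA, ← hα]
      exact hiter k
  refine ⟨hstep, fun k => ?_⟩
  have hgeom : V k ≤ (1 - √(m / L)) ^ k * V 0 := by
    induction k with
    | zero => simp
    | succ k ih =>
      rw [pow_succ', mul_assoc]
      exact (hstep k).trans (mul_le_mul_of_nonneg_left ih (hrate ▸ hr))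
  refine le_trans ?_ hgeom
  rw [hV]
  exact le_add_of_nonneg_left (sq_nonneg _)
end

section
/- Let f : ℝ^p → ℝ have a finite minimum value f⋆ (i.e., f(z) ≥ f⋆ for all z). Let ξ : ℕ → ℝⁿ, w : ℕ → ℝᵐ and z : ℕ → ℝ^p be sequences, let S : ℝⁿ × ℝᵐ → ℝ, and let V : ℝⁿ → ℝ satisfy V(ξ) ≥ 0 for all ξ. Suppose V(ξ_{k+1}) − V(ξ_k) ≤ S(ξ_k, w_k) and S(ξ_k, w_k) ≤ −(f(z_k) − f⋆) for all k. Then for every T: (i) Σ_{k=0}^{T} (f(z_k) − f⋆) ≤ V(ξ₀); (ii) min_{0 ≤ k ≤ T} (f(z_k) − f⋆) ≤ V(ξ₀)/(T+1); and (iii) if moreover f(z_{k+1}) ≤ f(z_k) for all k, then f(z_T) − f⋆ ≤ V(ξ₀)/(T+1). -/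
/-- A sequence whose terms are bounded by the decrements of a nonnegative sequence has partial sums
bounded by the initial value of that sequence. -/
theorem sum_range_le_of_le_sub_succ {a v : ℕ → ℝ} (hv : ∀ k, 0 ≤ v k)
    (h : ∀ k, a k ≤ v k - v (k + 1)) (N : ℕ) : ∑ k ∈ Finset.range N, a k ≤ v 0 :=
  calc ∑ k ∈ Finset.range N, a k
      ≤ ∑ k ∈ Finset.range N, (v k - v (k + 1)) := Finset.sum_le_sum fun k _ => h k
    _ = v 0 - v N := Finset.sum_range_sub' v N
    _ ≤ v 0 := sub_le_self _ (hv N)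

/-- Among the first `T + 1` terms of a sequence, some term is at most the average bound. -/
theorem exists_le_div_of_sum_range_le {a : ℕ → ℝ} {C : ℝ} {T : ℕ}
    (h : ∑ k ∈ Finset.range (T + 1), a k ≤ C) : ∃ k ≤ T, a k ≤ C / (T + 1) := by
  have hC : ∑ _k ∈ Finset.range (T + 1), C / ((T : ℝ) + 1) = C := by
    rw [Finset.sum_const, Finset.card_range, nsmul_eq_mul]
    push_cast
    field_simp
  obtain ⟨k, hk, hle⟩ := Finset.exists_le_of_sum_le Finset.nonempty_range_add_one
    (h.trans_eq hC.symm)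
  exact ⟨k, Nat.lt_succ_iff.mp (Finset.mem_range.mp hk), hle⟩

/-- Theorem 6 of the paper: a dissipation inequality with a supply rate bounded by the negative
suboptimality implies an `O(1/k)` sublinear convergence rate. -/
theorem sublinear_rate_from_dissipation {p n m : ℕ} (f : EuclideanSpace ℝ (Fin p) → ℝ)
    (fstar : ℝ) (hfstar : ∀ z, fstar ≤ f z)
    (ξ : ℕ → Fin n → ℝ) (w : ℕ → Fin m → ℝ) (z : ℕ → EuclideanSpace ℝ (Fin p))
    (S : (Fin n → ℝ) → (Fin m → ℝ) → ℝ)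
    (V : (Fin n → ℝ) → ℝ) (hV : ∀ ξ', 0 ≤ V ξ')
    (hdiss : ∀ k, V (ξ (k + 1)) - V (ξ k) ≤ S (ξ k) (w k))
    (hsupply : ∀ k, S (ξ k) (w k) ≤ -(f (z k) - fstar)) :
    ∀ T : ℕ,
      (∑ k ∈ Finset.range (T + 1), (f (z k) - fstar)) ≤ V (ξ 0) ∧
      (∃ k ≤ T, f (z k) - fstar ≤ V (ξ 0) / (T + 1)) ∧
      ((∀ k, f (z (k + 1)) ≤ f (z k)) → f (z T) - fstar ≤ V (ξ 0) / (T + 1)) := by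
  intro T
  have hsum := sum_range_le_of_le_sub_succ (a := fun k => f (z k) - fstar) (fun k => hV (ξ k))
    (fun k => by linarith [hdiss k, hsupply k]) (T + 1)
  obtain ⟨k, hkT, hk⟩ := exists_le_div_of_sum_range_le hsum
  refine ⟨hsum, ⟨k, hkT, hk⟩, fun hmono => ?_⟩
  have hanti : f (z T) ≤ f (z k) := antitone_nat_of_succ_le (f := fun k => f (z k)) hmono hkT
  exact (sub_le_sub_right hanti fstar).trans hk
end

section
/- Let A_k be n×n real matrices, B_k n×m real matrices, and X_k symmetric (n+m)×(n+m) real matrices, for k ∈ ℕ. Suppose there exist positive semidefinite n×n real matrices P_k such that for every k the block matrix [[A_kᵀP_{k+1}A_k − P_k, A_kᵀP_{k+1}B_k], [B_kᵀP_{k+1}A_k, B_kᵀP_{k+1}B_k]] − X_k is negative semidefinite. Then for every pair of sequences ξ : ℕ → ℝⁿ and w : ℕ → ℝᵐ with ξ_{k+1} = A_kξ_k + B_kw_k for all k, the time-dependent storage functions V_k(ξ) := ξᵀP_kξ satisfy V_{k+1}(ξ_{k+1}) − V_k(ξ_k) ≤ (ξ_k; w_k)ᵀ X_k (ξ_k;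 w_k) for all k, where (ξ_k; w_k) ∈ ℝ^{n+m} denotes the stacked vector. -/
open Matrix

theorem dotProduct_transpose_mul_mul_mulVec_s14 {R ι ι' l p : Type*} [CommRing R]
    [Fintype ι] [Fintype ι'] [Fintype l] [Fintype p]
    (C : Matrix ι l R) (Q : Matrix ι ι' R) (D : Matrix ι' p R) (v : l → R) (z : p → R) :
    v ⬝ᵥ (Cᵀ * Q * D).mulVec z = C.mulVec v ⬝ᵥ Q.mulVec (D.mulVec z) := by
  rw [← mulVec_mulVec, ← mulVec_mulVec, dotProduct_mulVec, vecMul_transpose]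

/-- The quadratic form of the LTV storage increment, evaluated at a stacked vector. -/
theorem dotProduct_fromBlocks_storage_mulVec {R ι κ : Type*} [CommRing R] [Fintype ι] [Fintype κ]
    (A P Q : Matrix ι ι R) (B : Matrix ι κ R) (x : ι → R) (u : κ → R) :
    Sum.elim x u ⬝ᵥ (Matrix.fromBlocks (Aᵀ * Q * A - P) (Aᵀ * Q * B)
        (Bᵀ * Q * A) (Bᵀ * Q * B)).mulVec (Sum.elim x u) =
      (A.mulVec x + B.mulVec u) ⬝ᵥ Q.mulVec (A.mulVec x + B.mulVec u) - x ⬝ᵥ P.mulVec x := by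
  simp only [fromBlocks_mulVec, Sum.elim_comp_inl, Sum.elim_comp_inr, sumElim_dotProduct_sumElim,
    sub_mulVec, dotProduct_add, dotProduct_sub, add_dotProduct, mulVec_add, dotProduct_transpose_mul_mul_mulVec_s14]
  ring

/-- Dissipation inequality construction for linear time-varying (LTV) systems
`ξ_{k+1} = A_kξ_k + B_kw_k`. -/
theorem LTV_dissipation_inequality {n m : ℕ}
    (A : ℕ → Matrix (Fin n) (Fin n) ℝ) (B : ℕ → Matrix (Fin n) (Fin m) ℝ)
    (X : ℕ → Matrix (Fin n ⊕ Fin m) (Fin n ⊕ Fin m) ℝ) (hX : ∀ k, (X k).IsSymm)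
    (P : ℕ → Matrix (Fin n) (Fin n) ℝ)
    (hPsd : ∀ k, ∀ v : Fin n → ℝ, 0 ≤ v ⬝ᵥ (P k).mulVec v)
    (hLMI : ∀ k, ∀ v : Fin n ⊕ Fin m → ℝ,
      v ⬝ᵥ ((Matrix.fromBlocks ((A k)ᵀ * P (k + 1) * A k - P k) ((A k)ᵀ * P (k + 1) * B k)
        ((B k)ᵀ * P (k + 1) * A k) ((B k)ᵀ * P (k + 1) * B k) - X k).mulVec v) ≤ 0)
    (ξ : ℕ → Fin n → ℝ) (w : ℕ → Fin m → ℝ)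
    (hdyn : ∀ k, ξ (k + 1) = (A k).mulVec (ξ k) + (B k).mulVec (w k)) :
    ∀ k, (ξ (k + 1)) ⬝ᵥ (P (k + 1)).mulVec (ξ (k + 1)) - (ξ k) ⬝ᵥ (P k).mulVec (ξ k) ≤
      (Sum.elim (ξ k) (w k)) ⬝ᵥ (X k).mulVec (Sum.elim (ξ k) (w k)) := by
  intro k
  have h := hLMI k (Sum.elim (ξ k) (w k))
  rw [sub_mulVec, dotProduct_sub, dotProduct_fromBlocks_storage_mulVec, ← hdyn k] at h
  exact sub_nonpos.mp h
end

section
/- Let A_k be n×n real matrices, B_k n×m real matrices, and M_k, N_k symmetric (n+m)×(n+m) real matrices, for k ∈ ℕ. Let μ : ℕ → ℝ be nonnegative and nondecreasing, and suppose there exist positive semidefinite n×n real matrices P_k such that for every k the block matrix [[A_kᵀP_{k+1}A_k − P_k, A_kᵀP_{k+1}B_k], [B_kᵀP_{k+1}A_k, B_kᵀP_{k+1}B_k]] − μ_kM_k − (μ_{k+1} − μ_k)N_k is negative semidefinite. Let ξ : ℕ → ℝⁿ and w : ℕ → ℝᵐ satisfy ξ_{k+1} = A_kξ_k + B_kw_k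 for all k, and let φ : ℕ → ℝ be a nonnegative sequence such that for all k, (ξ_k; w_k)ᵀ(μ_kM_k + (μ_{k+1} − μ_k)N_k)(ξ_k; w_k) ≤ μ_kφ_k − μ_{k+1}φ_{k+1}. Then for every k with μ_k > 0, φ_k ≤ (μ₀φ₀ + ξ₀ᵀP₀ξ₀)/μ_k. -/
open Matrix

/-- The block quadratic form at `(x; u)` is the one-step increment of the storage function. -/
theorem dotProduct_fromBlocks_mulVec_eq_increment {n m R : Type*} [Fintype n] [Fintype m]
    [CommRing R] (A : Matrix n n R) (B : Matrix n m R) (P Q : Matrix n n R)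
    (x : n → R) (u : m → R) :
    Sum.elim x u ⬝ᵥ (Matrix.fromBlocks (Aᵀ * Q * A - P) (Aᵀ * Q * B)
        (Bᵀ * Q * A) (Bᵀ * Q * B)).mulVec (Sum.elim x u) =
      (A.mulVec x + B.mulVec u) ⬝ᵥ Q.mulVec (A.mulVec x + B.mulVec u) - x ⬝ᵥ P.mulVec x := by
  simp only [Matrix.fromBlocks_mulVec, sumElim_dotProduct_sumElim, Sum.elim_comp_inl,
    Sum.elim_comp_inr, Matrix.sub_mulVec, ← Matrix.mulVec_mulVec, Matrix.mulVec_add,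
    dotProduct_add, add_dotProduct, dotProduct_sub, Matrix.dotProduct_transpose_mulVec,
    dotProduct_comm (A.mulVec x), dotProduct_comm (B.mulVec u)]
  ring

/-- Theorem 9 of the paper: the LTV dissipativity LMI together with the time-dependent
supply-rate bound yields the sublinear rate `φ_k ≤ (μ₀φ₀ + ξ₀ᵀP₀ξ₀)/μ_k`. -/
theorem LTV_sublinear_rate {n m : ℕ}
    (A : ℕ → Matrix (Fin n) (Fin n) ℝ) (B : ℕ → Matrix (Fin n) (Fin m) ℝ)
    (M N : ℕ → Matrix (Fin n ⊕ Fin m) (Fin n ⊕ Fin m) ℝ)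
    (hM : ∀ k, (M k).IsSymm) (hN : ∀ k, (N k).IsSymm)
    (μ : ℕ → ℝ) (hμ0 : ∀ k, 0 ≤ μ k) (hμmono : ∀ k, μ k ≤ μ (k + 1))
    (P : ℕ → Matrix (Fin n) (Fin n) ℝ)
    (hPsd : ∀ k, ∀ v : Fin n → ℝ, 0 ≤ v ⬝ᵥ (P k).mulVec v)
    (hLMI : ∀ k, ∀ v : Fin n ⊕ Fin m → ℝ,
      v ⬝ᵥ ((Matrix.fromBlocks ((A k)ᵀ * P (k + 1) * A k - P k) ((A k)ᵀ * P (k + 1) * B k)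
          ((B k)ᵀ * P (k + 1) * A k) ((B k)ᵀ * P (k + 1) * B k)
        - μ k • M k - (μ (k + 1) - μ k) • N k).mulVec v) ≤ 0)
    (ξ : ℕ → Fin n → ℝ) (w : ℕ → Fin m → ℝ)
    (hdyn : ∀ k, ξ (k + 1) = (A k).mulVec (ξ k) + (B k).mulVec (w k))
    (φ : ℕ → ℝ) (hφ : ∀ k, 0 ≤ φ k)
    (hsupply : ∀ k, (Sum.elim (ξ k) (w k)) ⬝ᵥ
        ((μ k • M k + (μ (k + 1) - μ k) • N k).mulVec (Sum.elim (ξ k) (w k))) ≤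
      μ k * φ k - μ (k + 1) * φ (k + 1)) :
    ∀ k, 0 < μ k → φ k ≤ (μ 0 * φ 0 + (ξ 0) ⬝ᵥ (P 0).mulVec (ξ 0)) / μ k := by
  have step (k : ℕ) : μ (k + 1) * φ (k + 1) + ξ (k + 1) ⬝ᵥ (P (k + 1)).mulVec (ξ (k + 1)) ≤
      μ k * φ k + ξ k ⬝ᵥ (P k).mulVec (ξ k) := by
    have h := hLMI k (Sum.elim (ξ k) (w k))
    rw [sub_sub, Matrix.sub_mulVec, dotProduct_sub,
      dotProduct_fromBlocks_mulVec_eq_increment, ← hdyn k] at h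
    linarith [hsupply k]
  have lyapunov_antitone : Antitone fun k => μ k * φ k + ξ k ⬝ᵥ (P k).mulVec (ξ k) :=
    antitone_nat_of_succ_le step
  intro k hk
  rw [le_div_iff₀ hk]
  linarith [lyapunov_antitone (Nat.zero_le k), hPsd k (ξ k)]
end

section
/- Let A, B, X, P be matrix-valued functions of t ∈ ℝ, with A(t) n×n, B(t) n×m, X(t) symmetric (n+m)×(n+m), and P(t) n×n differentiable with derivative P'(t). Suppose for all t, P(t) is positive semidefinite and the block matrix [[A(t)ᵀP(t) + P(t)A(t) + P'(t), P(t)B(t)], [B(t)ᵀP(t), 0]] − X(t) is negative semidefinite. Then for every differentiable Λ : ℝ → ℝⁿ and W : ℝ → ℝᵐ satisfying Λ'(t) = A(t)Λ(t) + B(t)W(t) for all t, the storage function V(t) := Λ(t)ᵀP(t)Λ(t) is differentiable and satisfies V'(t) ≤ (Λ(t); W(t))ᵀ X(t) (Λ(t); W(t)) for all t, where (Λ(t); W(t)) ∈ ℝ^{n+m} denotes the stacked vector. -/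
open Matrix

/-- Product rule for the dot product of two vector-valued functions, entrywise. -/
theorem hasDerivAt_dotProduct {ι : Type*} [Fintype ι] {u v : ℝ → ι → ℝ} {u' v' : ι → ℝ} {t : ℝ}
    (hu : ∀ i, HasDerivAt (fun s => u s i) (u' i) t)
    (hv : ∀ i, HasDerivAt (fun s => v s i) (v' i) t) :
    HasDerivAt (fun s => u s ⬝ᵥ v s) (u' ⬝ᵥ v t + u t ⬝ᵥ v') t := by
  simp only [dotProduct, ← Finset.sum_add_distrib]
  exact HasDerivAt.fun_sum fun i _ => (hu i).fun_mul (hv i)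

/-- Product rule for the quadratic form `xᵀ P x` with time-varying `P` and `x`. -/
theorem hasDerivAt_dotProduct_mulVec {ι : Type*} [Fintype ι] {P : ℝ → Matrix ι ι ℝ}
    {P' : Matrix ι ι ℝ} {x : ℝ → ι → ℝ} {x' : ι → ℝ} {t : ℝ}
    (hP : ∀ i j, HasDerivAt (fun s => P s i j) (P' i j) t)
    (hx : ∀ i, HasDerivAt (fun s => x s i) (x' i) t) :
    HasDerivAt (fun s => x s ⬝ᵥ (P s).mulVec (x s))
      (x' ⬝ᵥ (P t).mulVec (x t) + x t ⬝ᵥ (P'.mulVec (x t) + (P t).mulVec x')) t :=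
  hasDerivAt_dotProduct hx fun i => hasDerivAt_dotProduct (hP i) hx

/-- The quadratic form of the dissipation block matrix is the derivative of the storage function
along `x' = A x + B w`. -/
theorem sumElim_dotProduct_fromBlocks_mulVec {ι κ : Type*} [Fintype ι] [Fintype κ]
    (A P Q : Matrix ι ι ℝ) (B : Matrix ι κ ℝ) (x : ι → ℝ) (w : κ → ℝ) :
    Sum.elim x w ⬝ᵥ (fromBlocks (Aᵀ * P + P * A + Q) (P * B) (Bᵀ * P) 0).mulVec (Sum.elim x w) =
      (A.mulVec x + B.mulVec w) ⬝ᵥ P.mulVec x +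
        x ⬝ᵥ (Q.mulVec x + P.mulVec (A.mulVec x + B.mulVec w)) := by
  simp only [fromBlocks_mulVec, Sum.elim_comp_inl, Sum.elim_comp_inr, sumElim_dotProduct_sumElim,
    add_mulVec, mulVec_add, zero_mulVec, ← mulVec_mulVec, dotProduct_add, add_dotProduct,
    dotProduct_transpose_mulVec, add_zero]
  rw [dotProduct_comm (P.mulVec x), dotProduct_comm (P.mulVec x)]
  ring

/-- Theorem 10 of the paper: the continuous-time dissipation inequality via an LMI for the
time-varying linear system `Λ̇ = A(t)Λ + B(t)W`. Derivatives of the matrix- and vector-valued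
functions are taken entrywise. -/
theorem continuous_dissipation_inequality {n m : ℕ}
    (A : ℝ → Matrix (Fin n) (Fin n) ℝ) (B : ℝ → Matrix (Fin n) (Fin m) ℝ)
    (X : ℝ → Matrix (Fin n ⊕ Fin m) (Fin n ⊕ Fin m) ℝ) (hX : ∀ t, (X t).IsSymm)
    (P P' : ℝ → Matrix (Fin n) (Fin n) ℝ)
    (hPdiff : ∀ t, ∀ i j, HasDerivAt (fun s => P s i j) (P' t i j) t)
    (hPsd : ∀ t, ∀ v : Fin n → ℝ, 0 ≤ v ⬝ᵥ (P t).mulVec v)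
    (hLMI : ∀ t, ∀ v : Fin n ⊕ Fin m → ℝ,
      v ⬝ᵥ ((Matrix.fromBlocks ((A t)ᵀ * P t + P t * A t + P' t) (P t * B t)
        ((B t)ᵀ * P t) 0 - X t).mulVec v) ≤ 0)
    (Λ : ℝ → Fin n → ℝ) (W : ℝ → Fin m → ℝ)
    (hW : ∀ i, Differentiable ℝ fun t => W t i)
    (hdyn : ∀ t, ∀ i, HasDerivAt (fun s => Λ s i)
      (((A t).mulVec (Λ t) + (B t).mulVec (W t)) i) t)
    (V : ℝ → ℝ) (hV : ∀ t, V t = (Λ t) ⬝ᵥ (P t).mulVec (Λ t)) :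
    (∀ t, DifferentiableAt ℝ V t) ∧
      ∀ t, deriv V t ≤ (Sum.elim (Λ t) (W t)) ⬝ᵥ (X t).mulVec (Sum.elim (Λ t) (W t)) := by
  have hderiv (t : ℝ) := hasDerivAt_dotProduct_mulVec (hPdiff t) (hdyn t)
  obtain rfl : V = fun t => Λ t ⬝ᵥ (P t).mulVec (Λ t) := funext hV
  refine ⟨fun t => (hderiv t).differentiableAt, fun t => ?_⟩
  have h := hLMI t (Sum.elim (Λ t) (W t))
  rw [sub_mulVec, dotProduct_sub, sumElim_dotProduct_fromBlocks_mulVec] at h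
  rw [(hderiv t).deriv]
  exact sub_nonpos.mp h
end
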